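/- There exists k₀ such that the following holds for all k ≥ k₀. Let T be a bipartite tournament with partite sets A, B and n = |V(T)| ≤ k⁴ vertices, let H be a feedback vertex set of T of size at most k, and let π be a topological sort of T − H. Set t = ⌈10 (log₂ k)³⌉ and q = ⌈(log₂ k)²⌉, and let F be a t-wise independent family of functions from V(T) to {1, …, q}. Then there exists f ∈ F such that, with Z_f = {v ∈ V(T) : f(v) = 1}: (i) every t consecutive vertices of π restricted to A \ H contain a vertex of Z_f, and every t consecutive vertices of π restricted to B \ H contain a vertex of Z_f; and (ii) |Z_f ∩ H| ≤ 2k/(log₂ k)². -/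

import Mathlib

open Set

variable {V : Type*}

/-- The arc relation `E` restricted to the vertex set `S` has no directed cycle. -/
def AcyclicOn (E : V → V → Prop) (S : Set V) : Prop :=
  ∀ v : V, ¬ Relation.TransGen (fun x y => x ∈ S ∧ y ∈ S ∧ E x y) v v

/-- `E` is a bipartite tournament with partite sets `A` and `B`. -/
def IsBipartiteTournament (E : V → V → Prop) (A B : Set V) : Prop :=
  A ∪ B = Set.univ ∧ A ∩ B = ∅ ∧
  (∀ a ∈ A, ∀ b ∈ B, Xor' (E a b) (E b a)) ∧
  (∀ u ∈ A, ∀ v ∈ A, ¬ E u v) ∧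
  (∀ u ∈ B, ∀ v ∈ B, ¬ E u v)

/-- `H` is a feedback vertex set: deleting `H` leaves an acyclic digraph. -/
def IsFVS (E : V → V → Prop) (H : Set V) : Prop := AcyclicOn E Hᶜ

/-- A directed cycle of length 4 (a square) on the distinct vertices `a b c d`. -/
def IsDirSquare (E : V → V → Prop) (a b c d : V) : Prop :=
  a ≠ b ∧ a ≠ c ∧ a ≠ d ∧ b ≠ c ∧ b ≠ d ∧ c ≠ d ∧
  E a b ∧ E b c ∧ E c d ∧ E d a

/-- Out-neighborhood. -/
def OutN (E : V → V → Prop) (v : V) : Set V := {u | E v u}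

/-- In-neighborhood. -/
def InN (E : V → V → Prop) (v : V) : Set V := {u | E u v}

/-- The union `X 1 ∪ ⋯ ∪ X (i-1)` of the sets preceding index `i` (1-based). -/
def SeqPrev (X : ℕ → Set V) (i : ℕ) : Set V := {v | ∃ j, 1 ≤ j ∧ j < i ∧ v ∈ X j}

/-- `X 1, …, X l` is the canonical sequence of the digraph induced by `E` on `S`:
`X i` is the set of vertices with no incoming arc in the graph induced on
`S \ (X 1 ∪ ⋯ ∪ X (i-1))`, `l` is minimal with `X 1 ∪ ⋯ ∪ X l = S`, and
`X` is `∅` outside the indices `1, …, l`. -/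
def IsCanonicalSeq (E : V → V → Prop) (S : Set V) (l : ℕ) (X : ℕ → Set V) : Prop :=
  (∀ i, 1 ≤ i → i ≤ l →
    X i = {v | v ∈ S ∧ v ∉ SeqPrev X i ∧ ∀ u ∈ S, u ∉ SeqPrev X i → ¬ E u v}) ∧
  SeqPrev X (l + 1) = S ∧
  (∀ l', l' < l → SeqPrev X (l' + 1) ≠ S) ∧
  (∀ i, i = 0 ∨ l < i → X i = ∅)

/-- The digraph induced on `S` is `M`-consistent: for every `v ∈ S` the induced
subgraph on `M ∪ {v}` is acyclic. -/
def MConsistentOn (E : V → V → Prop) (S M : Set V) : Prop :=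
  ∀ v ∈ S, AcyclicOn E (M ∪ {v})

/-- `u` and `v` are `M`-equivalent. -/
def MEquiv (E : V → V → Prop) (M : Set V) (u v : V) : Prop :=
  OutN E u ∩ M = OutN E v ∩ M ∧ InN E u ∩ M = InN E v ∩ M

/-- `v` is `(M, X i)`-equivalent: `v` is `M`-equivalent to a vertex of `X i`. -/
def MXEquiv (E : V → V → Prop) (M : Set V) (X : ℕ → Set V) (i : ℕ) (v : V) : Prop :=
  ∃ u ∈ X i, MEquiv E M v u

/-- `v` is `(M, X i)`-conflicting. -/
def MXConflict (E : V → V → Prop) (X : ℕ → Set V) (i : ℕ) (v : V) : Prop :=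
  (OutN E v ∩ X i).Nonempty ∧ (InN E v ∩ X i).Nonempty ∧
  (∀ j, j < i → OutN E v ∩ X j = ∅) ∧
  (∀ j, i < j → InN E v ∩ X j = ∅)

/-- `π` is a topological sort of the digraph induced by `E` on `S`. -/
def IsTopSortOn (E : V → V → Prop) (S : Set V) (π : V → ℕ) : Prop :=
  Set.InjOn π S ∧ ∀ u ∈ S, ∀ w ∈ S, E u w → π u < π w

/-- `v` is `M⁻`-universal (w.r.t. the canonical sequence `X` of `T[M]`). -/
def MUnivMinus (E : V → V → Prop) (M : Set V) (X : ℕ → Set V) (v : V) : Prop :=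
  (∀ i, ¬ MXEquiv E M X i v) ∧ AcyclicOn E (M ∪ {v}) ∧
  ∃ π : V → ℕ, IsTopSortOn E (M ∪ {v}) π ∧ ∀ u ∈ M ∪ {v}, u ≠ v → π v < π u

/-- `v` is `M⁺`-universal (w.r.t. the canonical sequence `X` of `T[M]`). -/
def MUnivPlus (E : V → V → Prop) (M : Set V) (X : ℕ → Set V) (v : V) : Prop :=
  (∀ i, ¬ MXEquiv E M X i v) ∧ AcyclicOn E (M ∪ {v}) ∧
  ∃ π : V → ℕ, IsTopSortOn E (M ∪ {v}) π ∧ ∀ u ∈ M ∪ {v}, u ≠ v → π u < π v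

/-- `v` is `M`-universal. -/
def MUniversal (E : V → V → Prop) (M : Set V) (X : ℕ → Set V) (v : V) : Prop :=
  MUnivMinus E M X v ∨ MUnivPlus E M X v

/-- `(X 1, Y 1, …, X l, Y l)` is the `M`-sequence of the digraph induced by `E` on
the vertex set `S`, where `X'` is the canonical sequence of `T[M]`:  `X i` is the set
of all `(M, X' i)`-equivalent vertices of `S` and `Y i` the set of all
`(M, X' i)`-conflicting vertices of `S`, with `Y 1` additionally containing every
`M⁻`-universal vertex and `Y l` every `M⁺`-universal vertex of `S`. -/
def IsMSeqOn (E : V → V → Prop) (S M : Set V) (l : ℕ) (X' X Y : ℕ → Set V) : Prop :=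
  IsCanonicalSeq E M l X' ∧
  (∀ i, 1 ≤ i → i ≤ l → X i = {w | w ∈ S ∧ MXEquiv E M X' i w}) ∧
  (∀ i, 1 ≤ i → i ≤ l → Y i =
    {w | w ∈ S ∧ MXConflict E X' i w} ∪
    (if i = 1 then {w | w ∈ S ∧ MUnivMinus E M X' w} else ∅) ∪
    (if i = l then {w | w ∈ S ∧ MUnivPlus E M X' w} else ∅)) ∧
  (∀ i, i = 0 ∨ l < i → X i = ∅ ∧ Y i = ∅)

/-- Every collection of at least `t` consecutive vertices of `π` restricted to `S`
contains a vertex of `M`. -/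
def ConsecHitsOn (π : V → ℕ) (S M : Set V) (t : ℝ) : Prop :=
  ∀ u ∈ S, ∀ w ∈ S, π u ≤ π w →
    t ≤ ({x | x ∈ S ∧ π u ≤ π x ∧ π x ≤ π w}.ncard : ℝ) →
    ∃ m ∈ M ∩ S, π u ≤ π m ∧ π m ≤ π w

/-- A feedback vertex set `H` is `M`-homogeneous: some topological sort `π` of
`T − H` is such that every `10 (log₂ k)³` consecutive vertices of `π` restricted to
`A \ H`, respectively to `B \ H`, contain a vertex of `M`. -/
def MHomogeneous (E : V → V → Prop) (A B M H : Set V) (k : ℕ) : Prop :=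
  ∃ π : V → ℕ, IsTopSortOn E Hᶜ π ∧
    ConsecHitsOn π (A \ H) M (10 * (Real.logb 2 k) ^ 3) ∧
    ConsecHitsOn π (B \ H) M (10 * (Real.logb 2 k) ^ 3)

/-- The left boundary of block `i`: vertices of `X i` occurring before the first
`M`-vertex of `X i` in the topological sort `π`. -/
def LeftBd (π : V → ℕ) (X : ℕ → Set V) (M : Set V) (i : ℕ) : Set V :=
  {x | x ∈ X i ∧ ∀ m ∈ X i ∩ M, π x < π m}

/-- The right boundary of block `i`: vertices of `X i` occurring after the last
`M`-vertex of `X i` in the topological sort `π`. -/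
def RightBd (π : V → ℕ) (X : ℕ → Set V) (M : Set V) (i : ℕ) : Set V :=
  {x | x ∈ X i ∧ ∀ m ∈ X i ∩ M, π m < π x}

/-- The vicinity of block `i`. -/
def Vicinity (π : V → ℕ) (X Y : ℕ → Set V) (M : Set V) (i : ℕ) : Set V :=
  LeftBd π X M i ∪ RightBd π X M i ∪ Y i ∪ RightBd π X M (i - 1) ∪ LeftBd π X M (i + 1)

/-- `F` is a `t`-wise independent family of functions from `V` to `{1, …, q}`. -/
def TwiseIndep (F : Finset (V → ℕ)) (t q : ℕ) : Prop :=
  F.Nonempty ∧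
  (∀ f ∈ F, ∀ v : V, f v ∈ Finset.Icc 1 q) ∧
  ∀ g : Fin t → V, Function.Injective g →
    ∀ α : Fin t → ℕ, (∀ i, α i ∈ Finset.Icc 1 q) →
      (F.filter fun f => ∀ i, f (g i) = α i).card * q ^ t = F.card

/-- `u` and `v` are false twins. -/
def FalseTwins (E : V → V → Prop) (u v : V) : Prop :=
  ¬ E u v ∧ ¬ E v u ∧ OutN E u = OutN E v ∧ InN E u = InN E v

/-- The vertex set of a quadruple (used for vertex sets of squares). -/
def quadVerts (q : V × V × V × V) : Set V := {q.1, q.2.1, q.2.2.1, q.2.2.2}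

/-- For a `t`-wise independent family, the events `f (g i) ∈ S i` on `t` distinct points `g i`
behave as for independent uniform values. -/
lemma TwiseIndep.card_filter_mem {F : Finset (V → ℕ)} {t q : ℕ} (hF : TwiseIndep F t q)
    {g : Fin t → V} (hg : Function.Injective g) (S : Fin t → Finset ℕ)
    (hS : ∀ i, S i ⊆ Finset.Icc 1 q) :
    (F.filter fun f => ∀ i, f (g i) ∈ S i).card * q ^ t = (∏ i, (S i).card) * F.card := by
  classical
  rw [Finset.card_eq_sum_card_fiberwise (f := fun f i => f (g i)) (t := Fintype.piFinset S)
    (by intro f hf; simpa using (Finset.mem_filter.1 hf).2), Finset.sum_mul,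
    ← Fintype.card_piFinset, ← smul_eq_mul, ← Finset.sum_const]
  refine Finset.sum_congr rfl fun α hα => ?_
  rw [Fintype.mem_piFinset] at hα
  rw [← hF.2.2 g hg α fun i => hS i (hα i), Finset.filter_filter]
  congr 2
  refine Finset.filter_congr fun f _ => ?_
  constructor
  · rintro ⟨-, h⟩ i
    exact congrFun h i
  · intro h
    exact ⟨fun i => (h i).symm ▸ hα i, funext h⟩

lemma TwiseIndep.one_le {F : Finset (V → ℕ)} {t q : ℕ} (hF : TwiseIndep F t q) [Nonempty V] :
    1 ≤ q := by
  obtain ⟨f, hf⟩ := hF.1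
  have h := Finset.mem_Icc.1 (hF.2.1 f hf (Classical.arbitrary V))
  exact h.1.trans h.2

/-- The values of a `t`-wise independent family at a single point are uniform. -/
lemma TwiseIndep.card_filter_eq_one [Fintype V] {F : Finset (V → ℕ)} {t q : ℕ}
    (hF : TwiseIndep F t q) (ht : 1 ≤ t) (htV : t ≤ Fintype.card V) (v : V) :
    (F.filter fun f => f v = 1).card * q = F.card := by
  classical
  have : Nonempty V := ⟨v⟩
  have hq := hF.one_le
  obtain ⟨s, rfl⟩ : ∃ s, t = s + 1 := ⟨t - 1, by omega⟩
  obtain ⟨e⟩ : Nonempty (Fin (s + 1) ↪ V) :=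
    Function.Embedding.nonempty_of_card_le (by simpa using htV)
  let g : Fin (s + 1) → V := fun i => Equiv.swap (e 0) v (e i)
  have hg : Function.Injective g := (Equiv.swap (e 0) v).injective.comp e.injective
  have hg0 : g 0 = v := Equiv.swap_apply_left _ _
  have h := hF.card_filter_mem hg (Fin.cons {1} fun _ => Finset.Icc 1 q) (by
    intro i
    refine Fin.cases ?_ (fun j => ?_) i
    · simpa using hq
    · simp)
  have hfilter : (F.filter fun f => ∀ i, f (g i) ∈
      (Fin.cons {1} fun _ => Finset.Icc 1 q : Fin (s + 1) → Finset ℕ) i) =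
      F.filter fun f => f v = 1 := by
    refine Finset.filter_congr fun f hf => ?_
    rw [Fin.forall_fin_succ]
    simp only [Fin.cons_zero, Fin.cons_succ, Finset.mem_singleton, hg0]
    exact and_iff_left fun i => hF.2.1 f hf _
  rw [hfilter, Fin.prod_univ_succ] at h
  simp only [Fin.cons_zero, Fin.cons_succ, Finset.card_singleton, Nat.card_Icc,
    Nat.add_sub_cancel, Finset.prod_const, Finset.card_univ, Fintype.card_fin, one_mul] at h
  apply Nat.eq_of_mul_eq_mul_left (pow_pos hq s)
  rw [← h]
  ring

/-- The proportion of functions avoiding the value `1` on a set of size at least `t`. -/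
lemma TwiseIndep.card_filter_ne_one_le {F : Finset (V → ℕ)} {t q : ℕ}
    (hF : TwiseIndep F t q) (hq : 1 ≤ q) {P : Set V} (hP : P.Finite) (htP : t ≤ P.ncard)
    [DecidablePred fun f : V → ℕ => ∀ x ∈ P, f x ≠ 1] :
    ((F.filter fun f : V → ℕ => ∀ x ∈ P, f x ≠ 1).card : ℝ) ≤ Real.exp (-(t / q)) * F.card := by
  have := hP.fintype
  obtain ⟨e⟩ : Nonempty (Fin t ↪ P) := Function.Embedding.nonempty_of_card_le (by
    rw [Fintype.card_fin, ← Nat.card_eq_fintype_card]; exact htP)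
  have h := hF.card_filter_mem (g := fun i => (e i : V))
    (Subtype.val_injective.comp e.injective) (fun _ => (Finset.Icc 1 q).erase 1)
    fun _ => Finset.erase_subset _ _
  have hcard : ((Finset.Icc 1 q).erase 1).card = q - 1 := by
    rw [Finset.card_erase_of_mem (by simpa using hq), Nat.card_Icc, Nat.add_sub_cancel]
  simp only [hcard, Finset.prod_const, Finset.card_univ, Fintype.card_fin] at h
  have hle : (F.filter fun f : V → ℕ => ∀ x ∈ P, f x ≠ 1).card ≤
      (F.filter fun f => ∀ i, f (e i : V) ∈ (Finset.Icc 1 q).erase 1).card := by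
    refine Finset.card_le_card fun f hf => ?_
    rw [Finset.mem_filter] at hf ⊢
    exact ⟨hf.1, fun i => Finset.mem_erase.2 ⟨hf.2 _ (e i).2, hF.2.1 f hf.1 _⟩⟩
  have hq0 : (0 : ℝ) < q := by exact_mod_cast hq
  have hR := congrArg (Nat.cast : ℕ → ℝ) h
  push_cast [Nat.cast_sub hq] at hR
  have hpow : ((q : ℝ) - 1) ^ t ≤ Real.exp (-(t / q)) * (q : ℝ) ^ t := by
    have h1 : ((q : ℝ) - 1) ≤ Real.exp (-(1 / q)) * q := by
      have := mul_le_mul_of_nonneg_right (Real.one_sub_le_exp_neg (1 / (q : ℝ))) hq0.le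
      rwa [sub_mul, one_mul, one_div_mul_cancel hq0.ne'] at this
    have h2 : (0 : ℝ) ≤ (q : ℝ) - 1 := by
      have : (1 : ℝ) ≤ q := by exact_mod_cast hq
      linarith
    refine (pow_le_pow_left₀ h2 h1 t).trans_eq ?_
    rw [mul_pow, ← Real.exp_nat_mul]
    congr 2
    ring
  refine (Nat.cast_le.2 hle).trans (le_of_mul_le_mul_right ?_ (pow_pos hq0 t))
  rw [hR]
  calc ((q : ℝ) - 1) ^ t * F.card ≤ Real.exp (-(t / q)) * (q : ℝ) ^ t * F.card := by gcongr
    _ = _ := by ring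

open Classical in
/-- Union bound over all pairs of end points of a window. -/
lemma TwiseIndep.card_filter_not_consecHitsOn_le [Fintype V] {F : Finset (V → ℕ)} {t q : ℕ}
    (hF : TwiseIndep F t q) (hq : 1 ≤ q) (π : V → ℕ) (S : Set V) :
    ((F.filter fun f => ¬ ConsecHitsOn π S {v | f v = 1} t).card : ℝ) ≤
      (Fintype.card V : ℝ) ^ 2 * (Real.exp (-(t / q)) * F.card) := by
  let P : V × V → Set V := fun p => {x | x ∈ S ∧ π p.1 ≤ π x ∧ π x ≤ π p.2}
  let I : Finset (V × V) := Finset.univ.filter fun p => t ≤ (P p).ncard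
  have hsub : (F.filter fun f => ¬ ConsecHitsOn π S {v | f v = 1} t) ⊆
      I.biUnion fun p => F.filter fun f => ∀ x ∈ P p, f x ≠ 1 := by
    intro f hf
    rw [Finset.mem_filter] at hf
    obtain ⟨hfF, hf⟩ := hf
    simp only [ConsecHitsOn, not_forall] at hf
    obtain ⟨u, -, w, -, -, htP, hno⟩ := hf
    refine Finset.mem_biUnion.2 ⟨(u, w), Finset.mem_filter.2
      ⟨Finset.mem_univ _, by exact_mod_cast htP⟩, Finset.mem_filter.2 ⟨hfF, ?_⟩⟩
    rintro x ⟨hxS, hx⟩ hx1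
    exact hno ⟨x, ⟨hx1, hxS⟩, hx⟩
  have hI : (I.card : ℝ) ≤ (Fintype.card V : ℝ) ^ 2 := by
    have : I.card ≤ Fintype.card V ^ 2 := by
      rw [sq, ← Fintype.card_prod]
      exact Finset.card_le_univ I
    exact_mod_cast this
  have hterm : ∀ p ∈ I, ((F.filter fun f => ∀ x ∈ P p, f x ≠ 1).card : ℝ) ≤
      Real.exp (-(t / q)) * F.card := fun p hp =>
    hF.card_filter_ne_one_le hq (Set.toFinite _) (Finset.mem_filter.1 hp).2
  have hunion := Nat.cast_le (α := ℝ).2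
    ((Finset.card_le_card hsub).trans Finset.card_biUnion_le)
  rw [Nat.cast_sum] at hunion
  refine hunion.trans ((Finset.sum_le_card_nsmul _ _ _ hterm).trans ?_)
  rw [nsmul_eq_mul]
  gcongr

open Classical in
/-- Markov's inequality for the number of vertices of `H` with value `1`. -/
lemma TwiseIndep.card_filter_lt_ncard_mul_le [Fintype V] {F : Finset (V → ℕ)} {t q : ℕ}
    (hF : TwiseIndep F t q) (ht : 1 ≤ t) (htV : t ≤ Fintype.card V) (H : Set V) (a : ℝ) :
    ((F.filter fun f => a < (({v | f v = 1} ∩ H).ncard : ℝ)).card : ℝ) * a * q ≤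
      H.ncard * F.card := by
  have hdouble : ∑ f ∈ F, ({v | f v = 1} ∩ H).ncard =
      ∑ v ∈ H.toFinset, (F.filter fun f => f v = 1).card := by
    refine Eq.trans ?_ (Finset.sum_card_bipartiteAbove_eq_sum_card_bipartiteBelow
      fun (f : V → ℕ) v => f v = 1)
    refine Finset.sum_congr rfl fun f _ => ?_
    rw [← Set.ncard_coe_finset]
    congr 1
    ext v
    simp [Finset.bipartiteAbove, and_comm]
  have hsum : (∑ f ∈ F, ({v | f v = 1} ∩ H).ncard) * q = H.ncard * F.card := by
    rw [hdouble, Finset.sum_mul,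
      Finset.sum_congr rfl fun v _ => hF.card_filter_eq_one ht htV v, Finset.sum_const,
      smul_eq_mul, Set.ncard_eq_toFinset_card']
  have hmarkov : ((F.filter fun f => a < (({v | f v = 1} ∩ H).ncard : ℝ)).card : ℝ) * a ≤
      ∑ f ∈ F, (({v | f v = 1} ∩ H).ncard : ℝ) := by
    rw [← nsmul_eq_mul]
    exact (Finset.card_nsmul_le_sum _ _ _ fun f hf => (Finset.mem_filter.1 hf).2.le).trans
      (Finset.sum_le_sum_of_subset_of_nonneg (Finset.filter_subset _ _)
        fun _ _ _ => Nat.cast_nonneg _)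
  calc _ ≤ (∑ f ∈ F, (({v | f v = 1} ∩ H).ncard : ℝ)) * q := by gcongr
    _ = H.ncard * F.card := by exact_mod_cast hsum

lemma eventually_logb_pow_le :
    ∀ᶠ k : ℕ in Filter.atTop,
      5 ≤ k ∧ 3 ≤ Real.logb 2 k ∧
        10 * Real.logb 2 k ^ 3 + 1 ≤ 2 * k / Real.logb 2 k ^ 2 := by
  have h1 : ∀ᶠ k : ℕ in Filter.atTop, 3 ≤ Real.logb 2 k :=
    ((Real.tendsto_logb_atTop one_lt_two).comp tendsto_natCast_atTop_atTop).eventually_ge_atTop 3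
  have hlog : (0 : ℝ) < Real.log 2 ^ 5 := pow_pos (Real.log_pos one_lt_two) 5
  have h2 : ∀ᶠ k : ℕ in Filter.atTop, Real.log k ^ 5 ≤ Real.log 2 ^ 5 / 11 * k := by
    have h := (Real.isLittleO_pow_log_id_atTop (n := 5)).bound
      (show (0 : ℝ) < Real.log 2 ^ 5 / 11 by positivity)
    filter_upwards [tendsto_natCast_atTop_atTop.eventually h] with k hk
    simpa using (le_abs_self _).trans hk
  filter_upwards [Filter.eventually_ge_atTop 5, h1, h2] with k hk hL hk5
  refine ⟨hk, hL, ?_⟩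
  have hL5 : 11 * Real.logb 2 k ^ 5 ≤ k := by
    rw [Real.logb, div_pow, ← mul_div_assoc, div_le_iff₀ hlog]
    linarith
  set L := Real.logb 2 k
  have hL2 : 0 < L ^ 2 := by positivity
  rw [le_div_iff₀ hL2]
  have h35 : L ^ 2 ≤ L ^ 5 := pow_le_pow_right₀ (by linarith) (by norm_num)
  have hk0 : (0 : ℝ) ≤ k := Nat.cast_nonneg k
  nlinarith

lemma exp_neg_ceil_div_ceil_le {k : ℕ} (hk : 1 ≤ k) (hL : 3 ≤ Real.logb 2 k) :
    Real.exp (-((⌈10 * Real.logb 2 k ^ 3⌉₊ : ℝ) / ⌈Real.logb 2 k ^ 2⌉₊)) ≤ ((k : ℝ) ^ 9)⁻¹ := by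
  have hk0 : (0 : ℝ) < k := by exact_mod_cast hk
  have hlogk : Real.log k ≤ Real.logb 2 k := by
    rw [Real.logb, le_div_iff₀ (Real.log_pos one_lt_two)]
    have h0 : 0 ≤ Real.log k := Real.log_nonneg (by exact_mod_cast hk)
    have h2 : Real.log 2 ≤ 1 := by linarith [Real.log_two_lt_d9]
    nlinarith
  set L := Real.logb 2 k
  have ht : 10 * L ^ 3 ≤ (⌈10 * L ^ 3⌉₊ : ℝ) := Nat.le_ceil _
  have hq : (⌈L ^ 2⌉₊ : ℝ) < L ^ 2 + 1 := Nat.ceil_lt_add_one (by positivity)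
  have hq0 : (0 : ℝ) < ⌈L ^ 2⌉₊ := lt_of_lt_of_le (by positivity) (Nat.le_ceil (L ^ 2))
  have hdiv : 9 * Real.log k ≤ (⌈10 * L ^ 3⌉₊ : ℝ) / ⌈L ^ 2⌉₊ := by
    rw [le_div_iff₀ hq0]
    calc 9 * Real.log k * ⌈L ^ 2⌉₊ ≤ 9 * L * (L ^ 2 + 1) := by gcongr
      _ ≤ 10 * L ^ 3 := by
        nlinarith [mul_nonneg (show 0 ≤ L by linarith) (show 0 ≤ L ^ 2 - 9 by nlinarith)]
      _ ≤ _ := ht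
  calc _ ≤ Real.exp (-(9 * Real.log k)) := Real.exp_le_exp.2 (neg_le_neg hdiv)
    _ = ((k : ℝ) ^ 9)⁻¹ := by
      rw [Real.exp_neg, ← Real.exp_log (pow_pos hk0 9), Real.log_pow]
      norm_num

theorem stmt_15 :
    ∃ k₀ : ℕ, ∀ k : ℕ, k₀ ≤ k →
      ∀ (W : Type) [Fintype W] [DecidableEq W] (E : W → W → Prop) (A B : Set W),
        IsBipartiteTournament E A B → Fintype.card W ≤ k ^ 4 →
        ∀ H : Set W, IsFVS E H → H.ncard ≤ k →
        ∀ π : W → ℕ, IsTopSortOn E Hᶜ π →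
        ∀ F : Finset (W → ℕ),
          TwiseIndep F ⌈10 * (Real.logb 2 k) ^ 3⌉₊ ⌈(Real.logb 2 k) ^ 2⌉₊ →
          ∃ f ∈ F,
            ConsecHitsOn π (A \ H) {v | f v = 1}
              ((⌈10 * (Real.logb 2 k) ^ 3⌉₊ : ℝ)) ∧
            ConsecHitsOn π (B \ H) {v | f v = 1}
              ((⌈10 * (Real.logb 2 k) ^ 3⌉₊ : ℝ)) ∧
            (({v | f v = 1} ∩ H).ncard : ℝ) ≤ 2 * k / (Real.logb 2 k) ^ 2 := by
  classical
  obtain ⟨k₀, hk₀⟩ := Filter.eventually_atTop.1 eventually_logb_pow_le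
  refine ⟨k₀, fun k hk W _ _ E A B _ hW H _ hH π _ F hF => ?_⟩
  obtain ⟨hk5, hL, hLk⟩ := hk₀ k hk
  have hexp := exp_neg_ceil_div_ceil_le (by omega) hL
  have hqL : Real.logb 2 k ^ 2 ≤ (⌈Real.logb 2 k ^ 2⌉₊ : ℝ) := Nat.le_ceil _
  have htlt : (⌈10 * Real.logb 2 k ^ 3⌉₊ : ℝ) < 10 * Real.logb 2 k ^ 3 + 1 :=
    Nat.ceil_lt_add_one (by positivity)
  have ht : 1 ≤ ⌈10 * Real.logb 2 k ^ 3⌉₊ := Nat.one_le_ceil_iff.2 (by positivity)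
  have hq : 1 ≤ ⌈Real.logb 2 k ^ 2⌉₊ := Nat.one_le_ceil_iff.2 (by positivity)
  set L := Real.logb 2 k
  set t := ⌈10 * L ^ 3⌉₊
  set q := ⌈L ^ 2⌉₊
  have hcard_le (P : Set W) : P.ncard ≤ Fintype.card W :=
    (Set.ncard_le_card P).trans_eq Nat.card_eq_fintype_card
  rcases lt_or_ge (Fintype.card W) t with hWt | htW
  · have hvac (S M : Set W) : ConsecHitsOn π S M t := fun u _ w _ _ h =>
      absurd ((Nat.cast_le.1 h).trans (hcard_le _)) hWt.not_ge
    obtain ⟨f, hf⟩ := hF.1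
    refine ⟨f, hf, hvac _ _, hvac _ _, ?_⟩
    have : (({v | f v = 1} ∩ H).ncard : ℝ) ≤ t := by
      exact_mod_cast (hcard_le _).trans hWt.le
    linarith
  have hk0 : (5 : ℝ) ≤ k := by exact_mod_cast hk5
  have hFpos : (0 : ℝ) < F.card := by exact_mod_cast hF.1.card_pos
  have hwindow (S : Set W) :
      ((F.filter fun f => ¬ ConsecHitsOn π S {v | f v = 1} t).card : ℝ) ≤ F.card / 5 := by
    refine (hF.card_filter_not_consecHitsOn_le hq π S).trans ?_
    have hW' : (Fintype.card W : ℝ) ≤ (k : ℝ) ^ 4 := by exact_mod_cast hW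
    calc _ ≤ ((k : ℝ) ^ 4) ^ 2 * (((k : ℝ) ^ 9)⁻¹ * F.card) := by gcongr
      _ = F.card / k := by field_simp
      _ ≤ F.card / 5 := by gcongr
  have hsmall : ((F.filter fun f => 2 * k / L ^ 2 < (({v | f v = 1} ∩ H).ncard : ℝ)).card : ℝ) ≤
      F.card / 2 := by
    have h := hF.card_filter_lt_ncard_mul_le ht htW H (2 * k / L ^ 2)
    set c : ℝ := ((F.filter fun f => 2 * k / L ^ 2 < (({v | f v = 1} ∩ H).ncard : ℝ)).card : ℝ)
    have hH' : (H.ncard : ℝ) ≤ k := by exact_mod_cast hH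
    have hL2 : 0 < L ^ 2 := by positivity
    have h1 : c * (2 * k) ≤ k * F.card :=
      calc c * (2 * k) = c * (2 * k / L ^ 2) * L ^ 2 := by field_simp
        _ ≤ c * (2 * k / L ^ 2) * q := by gcongr
        _ ≤ H.ncard * F.card := h
        _ ≤ k * F.card := by gcongr
    nlinarith
  by_contra! hno
  have hcover : F ⊆ (F.filter fun f => ¬ ConsecHitsOn π (A \ H) {v | f v = 1} t) ∪
      (F.filter fun f => ¬ ConsecHitsOn π (B \ H) {v | f v = 1} t) ∪
      (F.filter fun f => 2 * k / L ^ 2 < (({v | f v = 1} ∩ H).ncard : ℝ)) := by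
    intro f hf
    have := hno f hf
    simp only [Finset.mem_union, Finset.mem_filter]
    tauto
  have hcount : (F.card : ℝ) ≤ _ := Nat.cast_le.2 ((Finset.card_le_card hcover).trans
    ((Finset.card_union_le _ _).trans (Nat.add_le_add_right (Finset.card_union_le _ _) _)))
  push_cast at hcount
  linarith [hwindow (A \ H), hwindow (B \ H)]
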